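/- Let 1 < p₁ ≤ q₁ < ∞ and I₀ := [0,1). There exists a 2×2 matrix weight W on I₀ (an integrable function W : I₀ → M₂(ℂ) with W(x) positive definite Hermitian for a.e. x) with [W]_{A_{p₁,q₁}(I₀)} < ∞ such that [W]_{A_{p₂,q₂},𝒟(I₀)} = ∞ for every choice of exponents 1 < p₂ ≤ q₂ < ∞ with p₁ < p₂ and q₂/p₂' = q₁/p₁'. -/

import Mathlib

open MeasureTheory ENNReal
open scoped ComplexOrder

noncomputable section

/-- The power `A^a` of a matrix, defined via the continuous functional calculus
(for positive definite Hermitian matrices this diagonalizes `A` and raises the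
eigenvalues to the `a`-th power). -/
def matRpow {d : ℕ} (A : Matrix (Fin d) (Fin d) ℂ) (a : ℝ) : Matrix (Fin d) (Fin d) ℂ :=
  cfc (fun x : ℝ => x ^ a) A

/-- The spectral norm (largest singular value) of a matrix, i.e. its norm as an operator
on the Euclidean space `ℂ^d`. -/
def specNorm {d : ℕ} (A : Matrix (Fin d) (Fin d) ℂ) : ℝ :=
  ‖Matrix.toEuclideanCLM (𝕜 := ℂ) A‖

/-- Hölder conjugate exponent. -/
def conjExp (p : ℝ) : ℝ := p / (p - 1)

/-- The Lebesgue average `⨍_Q f dμ` of an `ℝ≥0∞`-valued function. -/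
def lavg {α : Type*} [MeasurableSpace α] (μ : Measure α) (Q : Set α) (f : α → ℝ≥0∞) : ℝ≥0∞ :=
  (μ Q)⁻¹ * ∫⁻ x in Q, f x ∂μ

/-- The two-exponent matrix Muckenhoupt characteristic `[W]_{A_{p,q}}`, with the supremum
taken over a family `S` of sets. -/
def matApq {α : Type*} [MeasurableSpace α] {d : ℕ} (μ : Measure α) (S : Set (Set α))
    (W : α → Matrix (Fin d) (Fin d) ℂ) (p q : ℝ) : ℝ≥0∞ :=
  ⨆ Q ∈ S, lavg μ Q fun x =>
    (lavg μ Q fun y =>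
        ENNReal.ofReal (specNorm (matRpow (W x) (1 / q) * matRpow (W y) (-(1 / q))))
          ^ conjExp p) ^ (q / conjExp p)

/-- The endpoint matrix Muckenhoupt characteristic `[W]_{A_{t,∞}}`, with the supremum
taken over a family `S` of sets. -/
def matAtInfty {α : Type*} [MeasurableSpace α] {d : ℕ} (μ : Measure α) (S : Set (Set α))
    (W : α → Matrix (Fin d) (Fin d) ℂ) (t : ℝ) : ℝ≥0∞ :=
  ⨆ Q ∈ S, essSup (fun x =>
    lavg μ Q fun y =>
      ENNReal.ofReal (specNorm (matRpow (W x) (1 / t) * matRpow (W y) (-(1 / t)))) ^ t)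
    (μ.restrict Q)

/-- The scalar reverse Hölder characteristic `[w]_{RH_s}`, with the supremum taken over a
family `S` of sets. -/
def scalRH {α : Type*} [MeasurableSpace α] (μ : Measure α) (S : Set (Set α))
    (w : α → ℝ) (s : ℝ) : ℝ≥0∞ :=
  ⨆ Q ∈ S, (lavg μ Q fun x => ENNReal.ofReal (w x) ^ s) ^ (1 / s) /
    lavg μ Q fun x => ENNReal.ofReal (w x)

/-- The scalar reverse Hölder characteristic `[w]_{RH_∞}`, with the supremum taken over a
family `S` of sets. -/
def scalRHInfty {α : Type*} [MeasurableSpace α] (μ : Measure α) (S : Set (Set α))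
    (w : α → ℝ) : ℝ≥0∞ :=
  ⨆ Q ∈ S, essSup (fun x => ENNReal.ofReal (w x)) (μ.restrict Q) /
    lavg μ Q fun x => ENNReal.ofReal (w x)

/-- The matrix reverse Hölder characteristic `[W]_{RH_{t,s}}`. -/
def matRH {α : Type*} [MeasurableSpace α] {d : ℕ} (μ : Measure α) (S : Set (Set α))
    (W : α → Matrix (Fin d) (Fin d) ℂ) (t s : ℝ) : ℝ≥0∞ :=
  ⨆ (e : EuclideanSpace ℂ (Fin d)) (_ : e ≠ 0),
    scalRH μ S (fun x => ‖Matrix.toEuclideanCLM (𝕜 := ℂ) (matRpow (W x) (1 / t)) e‖ ^ t) s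

/-- The matrix reverse Hölder characteristic `[W]_{RH_{t,∞}}`. -/
def matRHInfty {α : Type*} [MeasurableSpace α] {d : ℕ} (μ : Measure α) (S : Set (Set α))
    (W : α → Matrix (Fin d) (Fin d) ℂ) (t : ℝ) : ℝ≥0∞ :=
  ⨆ (e : EuclideanSpace ℂ (Fin d)) (_ : e ≠ 0),
    scalRHInfty μ S (fun x => ‖Matrix.toEuclideanCLM (𝕜 := ℂ) (matRpow (W x) (1 / t)) e‖ ^ t)

/-- An axis-parallel cube in `ℝ^n` with corner `c` and positive side length `h`. -/
def cube {n : ℕ} (c : Fin n → ℝ) (h : ℝ) : Set (Fin n → ℝ) :=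
  {x | ∀ i, x i ∈ Set.Ico (c i) (c i + h)}

/-- The family of all axis-parallel cubes in `ℝ^n`. -/
def cubes (n : ℕ) : Set (Set (Fin n → ℝ)) :=
  {Q | ∃ (c : Fin n → ℝ) (h : ℝ), 0 < h ∧ Q = cube c h}

/-- The family of all (left-closed right-open, nontrivial, bounded) intervals in `ℝ`,
i.e. the axis-parallel "cubes" of `ℝ^1`. -/
def intervalsR : Set (Set ℝ) := {I | ∃ a b : ℝ, a < b ∧ I = Set.Ico a b}

/-- The family of all dyadic intervals `[m·2^k, (m+1)·2^k)`, `m, k ∈ ℤ`, in `ℝ`. -/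
def dyadicsR : Set (Set ℝ) :=
  {I | ∃ m k : ℤ, I = Set.Ico ((m : ℝ) * 2 ^ k) (((m : ℝ) + 1) * 2 ^ k)}

/-- A `d×d` matrix weight: a locally integrable matrix-valued function whose values are
a.e. positive definite (Hermitian). -/
def IsMatrixWeight {α : Type*} [MeasurableSpace α] [TopologicalSpace α] {d : ℕ}
    (μ : Measure α) (W : α → Matrix (Fin d) (Fin d) ℂ) : Prop :=
  (∀ i j, LocallyIntegrable (fun x => W x i j) μ) ∧ ∀ᵐ x ∂μ, (W x).PosDef


/-- The family of all (left-closed right-open, nontrivial) subintervals of `I₀ = [0,1)`. -/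
def subIntervalsI0 : Set (Set ℝ) :=
  {I | ∃ a b : ℝ, 0 ≤ a ∧ a < b ∧ b ≤ 1 ∧ I = Set.Ico a b}

/-- The family of all dyadic intervals `[m·2^k, (m+1)·2^k)` contained in `I₀ = [0,1)`. -/
def dyadicsI0 : Set (Set ℝ) :=
  {I | (∃ m k : ℤ, I = Set.Ico ((m : ℝ) * 2 ^ k) (((m : ℝ) + 1) * 2 ^ k)) ∧
    I ⊆ Set.Ico (0 : ℝ) 1}

/-- The orthogonal projection of `ℂ²` onto the line spanned by `(1, t)`. -/
def lineProj (t : ℝ) : Matrix (Fin 2) (Fin 2) ℂ :=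
  (((1 + t ^ 2)⁻¹ : ℝ) : ℂ) • !![1, (t : ℂ); (t : ℂ), (t : ℂ) ^ 2]

/-- The Hermitian matrix with eigenvalue `1` on the line spanned by `(1, t)` and eigenvalue `l` on
its orthogonal complement. -/
def lineStretch (t l : ℝ) : Matrix (Fin 2) (Fin 2) ℂ :=
  lineProj t + l • (1 - lineProj t)

theorem one_add_sq_ne_zero_complex (t : ℝ) : (1 + (t : ℂ) ^ 2) ≠ 0 := by
  have : (1 + t ^ 2) ≠ 0 := by positivity
  exact_mod_cast this

theorem lineProj_isIdempotentElem (t : ℝ) : IsIdempotentElem (lineProj t) := by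
  have h := one_add_sq_ne_zero_complex t
  ext i j
  fin_cases i <;> fin_cases j <;> simp [lineProj, Matrix.mul_apply] <;> field_simp

theorem lineProj_isHermitian (t : ℝ) : (lineProj t).IsHermitian := by
  ext i j
  fin_cases i <;> fin_cases j <;> simp [lineProj]

theorem cfc_lineStretch (t l : ℝ) {f : ℝ → ℝ} (hf : f 1 = 1) :
    cfc f (lineStretch t l) = lineStretch t (f l) := by
  have hsa : IsSelfAdjoint (lineProj t) := lineProj_isHermitian t
  have hspec : spectrum ℝ (lineProj t) ⊆ {0, 1} :=
    (lineProj_isIdempotentElem t).spectrum_subset ℝ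
  have hfin : (spectrum ℝ (lineProj t)).Finite := (Set.toFinite {0, 1}).subset hspec
  have key (m : ℝ) : lineStretch t m = cfc (fun s : ℝ => m + (1 - m) * s) (lineProj t) := by
    rw [cfc_const_add m (fun s => (1 - m) * s) (lineProj t) (hfin.continuousOn _) hsa,
      cfc_const_mul_id (1 - m) (lineProj t) hsa, Algebra.algebraMap_eq_smul_one, lineStretch]
    module
  rw [key l, ← cfc_comp f _ (lineProj t) hsa ((hfin.image _).continuousOn _)
    (hfin.continuousOn _), key]
  refine cfc_congr fun s hs => ?_
  rcases hspec hs with rfl | rfl <;> simp [hf]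

theorem matRpow_lineStretch (t l a : ℝ) :
    matRpow (lineStretch t l) a = lineStretch t (l ^ a) :=
  cfc_lineStretch t l (Real.one_rpow a)

theorem lineStretch_posDef (t : ℝ) {l : ℝ} (hl : 0 < l) (hl1 : l ≤ 1) :
    (lineStretch t l).PosDef := by
  have h : lineStretch t l = l • 1 + (1 - l) • lineProj t := by
    rw [lineStretch]; module
  rw [h]
  have hP : (lineProj t).PosSemidef := by
    have := Matrix.posSemidef_conjTranspose_mul_self (lineProj t)
    rwa [(lineProj_isHermitian t).eq, (lineProj_isIdempotentElem t).eq] at this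
  exact (Matrix.PosDef.one.smul hl).add_posSemidef (hP.smul (by linarith))

section
open scoped Matrix.Norms.L2Operator

theorem specNorm_eq_norm {d : ℕ} (A : Matrix (Fin d) (Fin d) ℂ) : specNorm A = ‖A‖ := rfl

theorem specNorm_nonneg {d : ℕ} (A : Matrix (Fin d) (Fin d) ℂ) : 0 ≤ specNorm A := norm_nonneg _

theorem norm_entry_le_l2_opNorm {d : ℕ} (A : Matrix (Fin d) (Fin d) ℂ) (i j : Fin d) :
    ‖A i j‖ ≤ ‖A‖ := by
  have h := (Matrix.toEuclideanCLM (𝕜 := ℂ) A).le_opNorm (EuclideanSpace.single j 1)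
  have h2 := PiLp.norm_apply_le (Matrix.toEuclideanCLM (𝕜 := ℂ) A (EuclideanSpace.single j 1)) i
  rw [PiLp.norm_single, norm_one, mul_one] at h
  refine le_trans (le_of_eq ?_) (h2.trans h)
  rw [Matrix.ofLp_toEuclideanCLM]
  simp

theorem l2_opNorm_le_sum_entries (A : Matrix (Fin 2) (Fin 2) ℂ) :
    ‖A‖ ≤ ‖A 0 0‖ + ‖A 0 1‖ + ‖A 1 0‖ + ‖A 1 1‖ := by
  refine ContinuousLinearMap.opNorm_le_bound _ (by positivity) fun v => ?_
  set y := Matrix.toEuclideanCLM (𝕜 := ℂ) A v with hy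
  have h0 : ‖y 0‖ ≤ (‖A 0 0‖ + ‖A 0 1‖) * ‖v‖ := by
    rw [hy, Matrix.ofLp_toEuclideanCLM]
    simp only [Matrix.mulVec, dotProduct, Fin.sum_univ_two]
    refine (norm_add_le _ _).trans ?_
    rw [norm_mul, norm_mul, add_mul]
    gcongr <;> exact PiLp.norm_apply_le v _
  have h1 : ‖y 1‖ ≤ (‖A 1 0‖ + ‖A 1 1‖) * ‖v‖ := by
    rw [hy, Matrix.ofLp_toEuclideanCLM]
    simp only [Matrix.mulVec, dotProduct, Fin.sum_univ_two]
    refine (norm_add_le _ _).trans ?_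
    rw [norm_mul, norm_mul, add_mul]
    gcongr <;> exact PiLp.norm_apply_le v _
  have hs : ‖y‖ ≤ ‖y 0‖ + ‖y 1‖ := by
    rw [EuclideanSpace.norm_eq, Fin.sum_univ_two, Real.sqrt_le_left (by positivity)]
    nlinarith [norm_nonneg (y 0), norm_nonneg (y 1)]
  have h : ‖y‖ ≤ (‖A 0 0‖ + ‖A 0 1‖ + ‖A 1 0‖ + ‖A 1 1‖) * ‖v‖ := by linarith
  exact h

theorem lineProj_norm_le_one (t : ℝ) : ‖lineProj t‖ ≤ 1 := by
  have h := Matrix.l2_opNorm_conjTranspose_mul_self (lineProj t)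
  rw [(lineProj_isHermitian t).eq, (lineProj_isIdempotentElem t).eq] at h
  nlinarith [norm_nonneg (lineProj t)]

theorem one_sub_lineProj_norm_le_one (t : ℝ) : ‖1 - lineProj t‖ ≤ 1 := by
  have h := Matrix.l2_opNorm_conjTranspose_mul_self (1 - lineProj t)
  rw [(Matrix.isHermitian_one.sub (lineProj_isHermitian t)).eq,
    (lineProj_isIdempotentElem t).one_sub.eq] at h
  nlinarith [norm_nonneg (1 - lineProj t)]

theorem lineProj_mul_one_sub_lineProj (s t : ℝ) :
    lineProj s * (1 - lineProj t) =
      (((t - s) * ((1 + s ^ 2)⁻¹ * (1 + t ^ 2)⁻¹) : ℝ) : ℂ) •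
        !![(t : ℂ), -1; (s : ℂ) * t, -s] := by
  have hs := one_add_sq_ne_zero_complex s
  have ht := one_add_sq_ne_zero_complex t
  ext i j
  fin_cases i <;> fin_cases j <;> simp [lineProj, Matrix.mul_apply] <;> field_simp <;> ring

theorem lineProj_mul_one_sub_lineProj_norm_le {s t : ℝ} (hs : 0 ≤ s) (hs1 : s ≤ 1) (ht : 0 ≤ t)
    (ht1 : t ≤ 1) : ‖lineProj s * (1 - lineProj t)‖ ≤ 4 * (s + t) := by
  have hc : |(t - s) * ((1 + s ^ 2)⁻¹ * (1 + t ^ 2)⁻¹)| ≤ s + t := by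
    have h1 : (1 + s ^ 2)⁻¹ * (1 + t ^ 2)⁻¹ ≤ 1 :=
      mul_le_one₀ (inv_le_one_of_one_le₀ (by nlinarith)) (by positivity)
        (inv_le_one_of_one_le₀ (by nlinarith))
    have h0 : 0 ≤ (1 + s ^ 2)⁻¹ * (1 + t ^ 2)⁻¹ := by positivity
    rw [abs_mul, abs_of_nonneg h0]
    have h2 : |t - s| ≤ s + t := by rw [abs_le]; constructor <;> linarith
    nlinarith [abs_nonneg (t - s)]
  rw [lineProj_mul_one_sub_lineProj, norm_smul, Complex.norm_real, Real.norm_eq_abs, mul_comm]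
  refine mul_le_mul ((l2_opNorm_le_sum_entries _).trans ?_) hc (abs_nonneg _) (by norm_num)
  simp [abs_of_nonneg hs, abs_of_nonneg ht]
  nlinarith

theorem le_lineProj_mul_one_sub_lineProj_norm {s t : ℝ} (hs : 0 ≤ s) (hs1 : s ≤ 1) (hst : s ≤ t)
    (ht1 : t ≤ 1) : (t - s) / 4 ≤ ‖lineProj s * (1 - lineProj t)‖ := by
  refine le_trans ?_ (norm_entry_le_l2_opNorm _ 0 1)
  rw [lineProj_mul_one_sub_lineProj]
  have h1 : (4 : ℝ)⁻¹ ≤ (1 + s ^ 2)⁻¹ * (1 + t ^ 2)⁻¹ := by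
    have hs2 : s ^ 2 ≤ 1 := pow_le_one₀ hs hs1
    have ht2 : t ^ 2 ≤ 1 := pow_le_one₀ (hs.trans hst) ht1
    rw [← mul_inv]
    exact inv_anti₀ (by positivity) (by nlinarith [sq_nonneg s, sq_nonneg t])
  have h0 : 0 ≤ (t - s) * ((1 + s ^ 2)⁻¹ * (1 + t ^ 2)⁻¹) :=
    mul_nonneg (by linarith) (by positivity)
  rw [Matrix.smul_apply, norm_smul, Complex.norm_real, Real.norm_of_nonneg h0]
  simp only [Matrix.of_apply, Matrix.cons_val', Matrix.cons_val_one, Matrix.cons_val_zero,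
    Matrix.cons_val_fin_one, norm_neg, norm_one, mul_one]
  rw [div_eq_mul_inv]
  exact mul_le_mul_of_nonneg_left h1 (by linarith)

theorem lineStretch_mul_lineStretch_norm_le {s t : ℝ} (hs : 0 < s) (hs1 : s ≤ 1) (ht : 0 < t)
    (ht1 : t ≤ 1) : ‖lineStretch s s * lineStretch t t⁻¹‖ ≤ 6 * (1 + s / t) := by
  have h : lineStretch s s * lineStretch t t⁻¹ =
      lineProj s * lineProj t + s • ((1 - lineProj s) * lineProj t) +
        t⁻¹ • (lineProj s * (1 - lineProj t)) +
        (s / t) • ((1 - lineProj s) * (1 - lineProj t)) := by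
    simp only [lineStretch, add_mul, mul_add, smul_mul_assoc, mul_smul_comm, smul_smul,
      div_eq_inv_mul, smul_add]
    abel
  rw [h]
  have hprod {A B : Matrix (Fin 2) (Fin 2) ℂ} (hA : ‖A‖ ≤ 1) (hB : ‖B‖ ≤ 1) : ‖A * B‖ ≤ 1 :=
    (norm_mul_le A B).trans (mul_le_one₀ hA (norm_nonneg _) hB)
  have a1 := hprod (lineProj_norm_le_one s) (lineProj_norm_le_one t)
  have a2 := hprod (one_sub_lineProj_norm_le_one s) (lineProj_norm_le_one t)
  have a4 := hprod (one_sub_lineProj_norm_le_one s) (one_sub_lineProj_norm_le_one t)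
  have a3 := lineProj_mul_one_sub_lineProj_norm_le hs.le hs1 ht.le ht1
  have hst : 0 < s / t := by positivity
  have b3 : t⁻¹ * ‖lineProj s * (1 - lineProj t)‖ ≤ 4 * (1 + s / t) := by
    calc _ ≤ t⁻¹ * (4 * (s + t)) := by gcongr
      _ = 4 * (1 + s / t) := by field_simp; ring
  refine (norm_add_le _ _).trans ?_
  refine (add_le_add_left (norm_add₃_le) _).trans ?_
  rw [norm_smul, norm_smul, norm_smul, Real.norm_of_nonneg hs.le,
    Real.norm_of_nonneg (inv_nonneg.2 ht.le), Real.norm_of_nonneg hst.le]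
  nlinarith [norm_nonneg ((1 - lineProj s) * lineProj t)]

theorem le_lineStretch_mul_lineStretch_norm {s t : ℝ} (hs : 0 ≤ s) (hs1 : s ≤ 1) (hst : s ≤ t)
    (ht1 : t ≤ 1) (l : ℝ) {m : ℝ} (hm : 0 ≤ m) :
    m * ((t - s) / 4) ≤ ‖lineStretch s l * lineStretch t m‖ := by
  have h : lineProj s * (lineStretch s l * lineStretch t m) * (1 - lineProj t) =
      m • (lineProj s * (1 - lineProj t)) := by
    have e1 : lineProj s * lineStretch s l = lineProj s := by
      rw [lineStretch, mul_add, mul_smul_comm, (lineProj_isIdempotentElem s).mul_one_sub_self,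
        (lineProj_isIdempotentElem s).eq, smul_zero, add_zero]
    have e2 : lineStretch t m * (1 - lineProj t) = m • (1 - lineProj t) := by
      rw [lineStretch, add_mul, smul_mul_assoc, (lineProj_isIdempotentElem t).mul_one_sub_self,
        (lineProj_isIdempotentElem t).one_sub.eq, zero_add]
    rw [← mul_assoc, e1, mul_assoc, e2, mul_smul_comm]
  calc m * ((t - s) / 4) ≤ m * ‖lineProj s * (1 - lineProj t)‖ := by
        gcongr
        exact le_lineProj_mul_one_sub_lineProj_norm hs hs1 hst ht1
    _ = ‖lineProj s * (lineStretch s l * lineStretch t m) * (1 - lineProj t)‖ := by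
        rw [h, norm_smul, Real.norm_of_nonneg hm]
    _ ≤ ‖lineProj s‖ * ‖lineStretch s l * lineStretch t m‖ * ‖1 - lineProj t‖ :=
        norm_mul₃_le
    _ ≤ 1 * ‖lineStretch s l * lineStretch t m‖ * 1 := by
        gcongr
        · exact lineProj_norm_le_one s
        · exact one_sub_lineProj_norm_le_one t
    _ = _ := by ring

end

theorem measure_div_mul_le_lavg {α : Type*} [MeasurableSpace α] {μ : Measure α} {S Q : Set α}
    (hS : MeasurableSet S) (hSQ : S ⊆ Q) {f : α → ℝ≥0∞} {k : ℝ≥0∞} (hf : ∀ x ∈ S, k ≤ f x) :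
    μ S / μ Q * k ≤ lavg μ Q f := by
  rw [lavg, div_eq_mul_inv, mul_comm (μ S), mul_assoc]
  gcongr
  calc μ S * k = ∫⁻ _ in S, k ∂μ := by rw [setLIntegral_const, mul_comm]
    _ ≤ ∫⁻ x in S, f x ∂μ := setLIntegral_mono' hS hf
    _ ≤ _ := lintegral_mono_set hSQ

theorem lavg_le_of_ae_le {α : Type*} [MeasurableSpace α] {μ : Measure α} {Q : Set α}
    (hQ : MeasurableSet Q) {f : α → ℝ≥0∞} {k : ℝ≥0∞} (hf : ∀ᵐ x ∂μ, x ∈ Q → f x ≤ k) :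
    lavg μ Q f ≤ k := by
  calc lavg μ Q f ≤ (μ Q)⁻¹ * ∫⁻ _ in Q, k ∂μ := by
        rw [lavg]
        gcongr 1
        exact setLIntegral_mono_ae' hQ hf
    _ = ((μ Q)⁻¹ * μ Q) * k := by rw [setLIntegral_const]; ring
    _ ≤ 1 * k := by gcongr; exact ENNReal.inv_mul_le_one _
    _ = k := one_mul k

theorem Ico_zero_mem_dyadicsI0 (n : ℕ) : Set.Ico (0 : ℝ) ((2 ^ n)⁻¹) ∈ dyadicsI0 := by
  refine ⟨⟨0, -n, by simp⟩, Set.Ico_subset_Ico_right ?_⟩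
  exact inv_le_one_of_one_le₀ (one_le_pow₀ (by norm_num))

/-- The weight with eigenvalues `1` and `x ^ (a * q)` whose unit eigenspace is spanned by
`(1, x ^ a)`. -/
def tiltedWeight (a q x : ℝ) : Matrix (Fin 2) (Fin 2) ℂ :=
  lineStretch (x ^ a) ((x ^ a) ^ q)

theorem matRpow_tiltedWeight (a q x r : ℝ) :
    matRpow (tiltedWeight a q x) r = lineStretch (x ^ a) (((x ^ a) ^ q) ^ r) :=
  matRpow_lineStretch _ _ _

theorem continuous_tiltedWeight {a q : ℝ} (ha : 0 < a) (hq : 0 < q) :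
    Continuous (tiltedWeight a q) := by
  have h1 : Continuous fun x : ℝ => x ^ a := Real.continuous_rpow_const ha.le
  have h2 : Continuous fun x : ℝ => (x ^ a) ^ q := (Real.continuous_rpow_const hq.le).comp h1
  have hP : Continuous fun x : ℝ => lineProj (x ^ a) := by
    refine Continuous.smul (Complex.continuous_ofReal.comp ?_) ?_
    · exact (continuous_const.add (h1.pow 2)).inv₀ fun x => (by positivity : (0 : ℝ) < 1 + (x ^ a) ^ 2).ne'
    · refine continuous_matrix fun i j => ?_
      fin_cases i <;> fin_cases j <;> simp <;> fun_prop
  exact hP.add (h2.smul (continuous_const.sub hP))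

theorem integrableOn_tiltedWeight {a q : ℝ} (ha : 0 < a) (hq : 0 < q) (i j : Fin 2) :
    IntegrableOn (fun x => tiltedWeight a q x i j) (Set.Ico (0 : ℝ) 1) volume :=
  ((((continuous_tiltedWeight ha hq).matrix_elem i j).continuousOn).integrableOn_compact
    isCompact_Icc).mono_set Set.Ico_subset_Icc_self

theorem tiltedWeight_posDef {a q x : ℝ} (ha : 0 < a) (hq : 0 < q) (hx : 0 < x) (hx1 : x ≤ 1) :
    (tiltedWeight a q x).PosDef :=
  lineStretch_posDef _ (by positivity)
    (Real.rpow_le_one (by positivity) (Real.rpow_le_one hx.le hx1 ha.le) hq.le)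

theorem ae_tiltedWeight_posDef {a q : ℝ} (ha : 0 < a) (hq : 0 < q) :
    ∀ᵐ x ∂(volume.restrict (Set.Ico (0 : ℝ) 1)), (tiltedWeight a q x).PosDef := by
  rw [ae_restrict_iff' measurableSet_Ico]
  filter_upwards [Measure.ae_ne volume (0 : ℝ)] with x hx hxI
  exact tiltedWeight_posDef ha hq (lt_of_le_of_ne hxI.1 hx.symm) hxI.2.le

theorem specNorm_tiltedWeight_rpow_le {a q r x y : ℝ} (ha : 0 < a) (hq : 0 < q) (hr : 0 ≤ r)
    (hx : 0 < x) (hx1 : x ≤ 1) (hy : 0 < y) (hy1 : y ≤ 1) :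
    specNorm (matRpow (tiltedWeight a q x) (1 / q) * matRpow (tiltedWeight a q y) (-(1 / q))) ^ r
      ≤ 12 ^ r * (1 + x ^ (a * r) * y ^ (-(a * r))) := by
  rw [matRpow_tiltedWeight, matRpow_tiltedWeight, Real.rpow_neg (by positivity), one_div,
    Real.rpow_rpow_inv (by positivity) hq.ne', Real.rpow_rpow_inv (by positivity) hq.ne']
  have hb := lineStretch_mul_lineStretch_norm_le (Real.rpow_pos_of_pos hx a)
    (Real.rpow_le_one hx.le hx1 ha.le) (Real.rpow_pos_of_pos hy a)
    (Real.rpow_le_one hy.le hy1 ha.le)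
  set u := x ^ a / y ^ a with hu
  have hu0 : 0 < u := by positivity
  have hur : u ^ r = x ^ (a * r) * y ^ (-(a * r)) := by
    rw [hu, Real.div_rpow (by positivity) (by positivity), ← Real.rpow_mul hx.le,
      ← Real.rpow_mul hy.le, Real.rpow_neg hy.le, div_eq_mul_inv]
  rw [← hur]
  refine (Real.rpow_le_rpow (specNorm_nonneg _) hb hr).trans ?_
  rcases le_total u 1 with h | h
  · calc (6 * (1 + u)) ^ r ≤ 12 ^ r := Real.rpow_le_rpow (by positivity) (by linarith) hr
      _ = 12 ^ r * 1 := (mul_one _).symm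
      _ ≤ _ := by gcongr; linarith [Real.rpow_pos_of_pos hu0 r]
  · calc (6 * (1 + u)) ^ r ≤ (12 * u) ^ r := Real.rpow_le_rpow (by positivity) (by linarith) hr
      _ = 12 ^ r * u ^ r := Real.mul_rpow (by norm_num) hu0.le
      _ ≤ _ := by gcongr; linarith

theorem lavg_one_add_inv_sqrt_le {α β x : ℝ} (hα : 0 ≤ α) (hαβ : α < β) (hx : 0 ≤ x)
    (hxβ : x ≤ β) {C : ℝ} (hC : 0 ≤ C) :
    lavg volume (Set.Ico α β)
      (fun y => ENNReal.ofReal (C * (1 + x ^ (1 / 2 : ℝ) * y ^ (-(1 / 2) : ℝ)))) ≤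
      ENNReal.ofReal (C * 3) := by
  have hi : IntervalIntegrable (fun y : ℝ => y ^ (-(1 / 2) : ℝ)) volume α β :=
    intervalIntegral.intervalIntegrable_rpow' (by norm_num)
  have hi2 : IntervalIntegrable (fun y : ℝ => C * (1 + x ^ (1 / 2 : ℝ) * y ^ (-(1 / 2) : ℝ)))
      volume α β := (intervalIntegrable_const.add (hi.const_mul _)).const_mul _
  have hint : ∫ y in α..β, C * (1 + x ^ (1 / 2 : ℝ) * y ^ (-(1 / 2) : ℝ)) =
      C * ((β - α) + √x * (2 * (√β - √α))) := by
    rw [intervalIntegral.integral_const_mul,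
      intervalIntegral.integral_add intervalIntegrable_const (hi.const_mul _),
      intervalIntegral.integral_const_mul, integral_rpow (Or.inl (by norm_num)),
      Real.sqrt_eq_rpow, Real.sqrt_eq_rpow, Real.sqrt_eq_rpow]
    norm_num
    ring_nf
    simp
  have hle : C * ((β - α) + √x * (2 * (√β - √α))) ≤ (β - α) * (C * 3) := by
    have h1 : √x ≤ √β := Real.sqrt_le_sqrt hxβ
    have h2 : √α ≤ √β := Real.sqrt_le_sqrt hαβ.le
    have h3 := Real.sq_sqrt hα
    have h4 := Real.sq_sqrt (hα.trans hαβ.le)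
    have h5 : √x * (√β - √α) ≤ β - α := by
      nlinarith [Real.sqrt_nonneg α, Real.sqrt_nonneg β, Real.sqrt_nonneg x]
    nlinarith
  have hpos : 0 < β - α := by linarith
  rw [lavg, ← ofReal_integral_eq_lintegral_ofReal, integral_Ico_eq_integral_Ioc,
    ← intervalIntegral.integral_of_le hαβ.le, hint, Real.volume_Ico]
  · refine (mul_le_mul_right (ENNReal.ofReal_le_ofReal hle) _).trans ?_
    rw [ENNReal.ofReal_mul hpos.le, ← mul_assoc,
      ENNReal.inv_mul_cancel (by simpa using hαβ) ENNReal.ofReal_ne_top, one_mul]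
  · rw [← IntegrableOn, integrableOn_Ico_iff_integrableOn_Ioo,
      ← integrableOn_Ioc_iff_integrableOn_Ioo]
    exact (intervalIntegrable_iff_integrableOn_Ioc_of_le hαβ.le).1 hi2
  · filter_upwards [ae_restrict_mem measurableSet_Ico] with y hy
    have : 0 ≤ y := hα.trans hy.1
    simp only [Pi.zero_apply]
    positivity

theorem matApq_tiltedWeight_lt_top {p q : ℝ} (hp : 1 < p) (hq : 0 < q) :
    matApq volume subIntervalsI0 (tiltedWeight (1 / (2 * conjExp p)) q) p q < ⊤ := by
  have hr : 0 < conjExp p := div_pos (by linarith) (by linarith)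
  have ha : 0 < 1 / (2 * conjExp p) := by positivity
  have har : 1 / (2 * conjExp p) * conjExp p = 1 / 2 := by field_simp
  have hC : ENNReal.ofReal (12 ^ conjExp p * 3) ^ (q / conjExp p) < ⊤ :=
    ENNReal.rpow_lt_top_of_nonneg (by positivity) ENNReal.ofReal_ne_top
  refine lt_of_le_of_lt (iSup₂_le ?_) hC
  rintro Q ⟨α, β, hα, hαβ, hβ, rfl⟩
  refine lavg_le_of_ae_le measurableSet_Ico ?_
  filter_upwards [Measure.ae_ne volume (0 : ℝ)] with x hx0 hx
  have hx' : 0 < x := lt_of_le_of_ne (hα.trans hx.1) hx0.symm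
  refine ENNReal.rpow_le_rpow ?_ (by positivity)
  refine le_trans ?_ (lavg_one_add_inv_sqrt_le hα hαβ hx'.le hx.2.le
    (C := 12 ^ conjExp p) (by positivity))
  rw [lavg, lavg]
  gcongr 1
  refine setLIntegral_mono_ae' measurableSet_Ico ?_
  filter_upwards [Measure.ae_ne volume (0 : ℝ)] with y hy0 hy
  have hy' : 0 < y := lt_of_le_of_ne (hα.trans hy.1) hy0.symm
  rw [ENNReal.ofReal_rpow_of_nonneg (specNorm_nonneg _) hr.le]
  refine ENNReal.ofReal_le_ofReal ?_
  have h := specNorm_tiltedWeight_rpow_le ha hq hr.le hx' (hx.2.le.trans hβ) hy'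
    (hy.2.le.trans hβ)
  rwa [har] at h

theorem le_specNorm_tiltedWeight {a q r x y : ℝ} (ha : 0 < a) (hx : 0 ≤ x) (hy : 0 < y)
    (hy1 : y ≤ 1) (hxy : x ≤ (1 / 2) ^ (1 / a) * y) :
    y ^ (-(a * (q / r - 1))) / 8 ≤
      specNorm (matRpow (tiltedWeight a q x) (1 / r) *
        matRpow (tiltedWeight a q y) (-(1 / r))) := by
  rw [matRpow_tiltedWeight, matRpow_tiltedWeight, specNorm_eq_norm]
  have hst : x ^ a ≤ 1 / 2 * y ^ a := by
    calc x ^ a ≤ ((1 / 2) ^ (1 / a) * y) ^ a := Real.rpow_le_rpow hx hxy ha.le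
      _ = 1 / 2 * y ^ a := by
        rw [Real.mul_rpow (by positivity) hy.le, one_div a,
          Real.rpow_inv_rpow (by norm_num) ha.ne']
  have hy0 : 0 < y ^ a := Real.rpow_pos_of_pos hy a
  have hya : y ^ a ≤ 1 := Real.rpow_le_one hy.le hy1 ha.le
  refine le_trans ?_ (le_lineStretch_mul_lineStretch_norm (Real.rpow_nonneg hx a) (by linarith)
    (by linarith) hya _ (by positivity))
  calc y ^ (-(a * (q / r - 1))) / 8
      = ((y ^ a) ^ q) ^ (-(1 / r)) * (y ^ a / 8) := by
        rw [← Real.rpow_mul hy.le, ← Real.rpow_mul hy.le, ← mul_div_assoc, ← Real.rpow_add hy]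
        ring_nf
    _ ≤ _ := mul_le_mul_of_nonneg_left (by linarith) (by positivity)

theorem matApq_tiltedWeight_eq_top {a q p₂ q₂ : ℝ} (ha : 0 < a) (hp₂ : 1 < p₂) (hq₂ : 0 < q₂)
    (hq : q₂ < q) : matApq volume dyadicsI0 (tiltedWeight a q) p₂ q₂ = ⊤ := by
  have hr : 0 < conjExp p₂ := div_pos (by linarith) (by linarith)
  have hc : 0 < q₂ / conjExp p₂ := by positivity
  have hγ : 0 < a * (q / q₂ - 1) := mul_pos ha (by rw [sub_pos, one_lt_div hq₂]; exact hq)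
  set γ := a * (q / q₂ - 1)
  set δ : ℝ := (1 / 2) ^ (1 / a) / 2 with hδ
  have hδ0 : 0 < δ := by positivity
  have hδ1 : δ ≤ 1 := by
    have : (1 / 2 : ℝ) ^ (1 / a) ≤ 1 :=
      Real.rpow_le_one (by norm_num) (by norm_num) (by positivity)
    linarith
  let K : ℕ → ℝ≥0∞ := fun n => ENNReal.ofReal (((2 : ℝ) ^ n) ^ γ / 8)
  have hK : Filter.Tendsto K Filter.atTop (nhds ⊤) :=
    ENNReal.tendsto_ofReal_nhds_top.2 <| Filter.Tendsto.atTop_div_const (by norm_num) <|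
      (tendsto_rpow_atTop hγ).comp (tendsto_pow_atTop_atTop_of_one_lt (by norm_num))
  have hcont : Continuous fun k : ℝ≥0∞ => ENNReal.ofReal δ *
      (ENNReal.ofReal (1 / 2) * k ^ conjExp p₂) ^ (q₂ / conjExp p₂) :=
    (ENNReal.continuous_const_mul ENNReal.ofReal_ne_top).comp <|
      ENNReal.continuous_rpow_const.comp <|
        (ENNReal.continuous_const_mul ENNReal.ofReal_ne_top).comp ENNReal.continuous_rpow_const
  have hlim := (hcont.tendsto ⊤).comp hK
  have htop : ENNReal.ofReal δ *
      (ENNReal.ofReal (1 / 2) * (⊤ : ℝ≥0∞) ^ conjExp p₂) ^ (q₂ / conjExp p₂) = ⊤ := by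
    rw [ENNReal.top_rpow_of_pos hr, ENNReal.mul_top (by simp), ENNReal.top_rpow_of_pos hc,
      ENNReal.mul_top (by simpa using hδ0)]
  rw [htop] at hlim
  refine top_le_iff.1 (le_of_tendsto' hlim fun n => ?_)
  refine le_trans ?_ (le_iSup₂_of_le _ (Ico_zero_mem_dyadicsI0 n) le_rfl)
  set h : ℝ := ((2 : ℝ) ^ n)⁻¹ with hh
  have hh0 : 0 < h := by positivity
  have hh1 : h ≤ 1 := inv_le_one_of_one_le₀ (one_le_pow₀ (by norm_num))
  have hfrac (b l : ℝ) :
      volume (Set.Ico b l) / volume (Set.Ico 0 h) = ENNReal.ofReal ((l - b) / h) := by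
    rw [Real.volume_Ico, Real.volume_Ico, sub_zero, ENNReal.ofReal_div_of_pos hh0]
  have hδh : volume (Set.Ico 0 (δ * h)) / volume (Set.Ico 0 h) = ENNReal.ofReal δ := by
    rw [hfrac, sub_zero, mul_div_cancel_right₀ _ hh0.ne']
  have hhalf : volume (Set.Ico (h / 2) h) / volume (Set.Ico 0 h) = ENNReal.ofReal (1 / 2) := by
    rw [hfrac]
    congr 1
    field_simp
    norm_num
  simp only [Function.comp_apply]
  rw [← hδh, ← hhalf]
  refine measure_div_mul_le_lavg measurableSet_Ico
    (Set.Ico_subset_Ico_right (mul_le_of_le_one_left hh0.le hδ1)) fun x hx => ?_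
  refine ENNReal.rpow_le_rpow ?_ hc.le
  refine measure_div_mul_le_lavg measurableSet_Ico
    (Set.Ico_subset_Ico_left (by positivity)) fun y hy => ?_
  have hy0 : 0 < y := lt_of_lt_of_le (by positivity) hy.1
  refine ENNReal.rpow_le_rpow (ENNReal.ofReal_le_ofReal ?_) hr.le
  refine le_trans ?_ (le_specNorm_tiltedWeight ha hx.1 hy0 (hy.2.le.trans hh1) ?_)
  · have hyh : h ^ (-γ) ≤ y ^ (-γ) :=
      Real.rpow_le_rpow_of_nonpos hy0 hy.2.le (by linarith)
    rw [hh, Real.inv_rpow (by positivity), Real.rpow_neg (by positivity), inv_inv] at hyh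
    gcongr
  · calc x ≤ δ * h := hx.2.le
      _ = (1 / 2) ^ (1 / a) * (h / 2) := by rw [hδ]; ring
      _ ≤ _ := by gcongr; exact hy.1

theorem statement8 (p₁ q₁ : ℝ) (hp₁ : 1 < p₁) (hpq₁ : p₁ ≤ q₁) :
    ∃ W : ℝ → Matrix (Fin 2) (Fin 2) ℂ,
      (∀ i j, IntegrableOn (fun x => W x i j) (Set.Ico (0 : ℝ) 1) volume) ∧
      (∀ᵐ x ∂(volume.restrict (Set.Ico (0 : ℝ) 1)), (W x).PosDef) ∧
      matApq volume subIntervalsI0 W p₁ q₁ < ⊤ ∧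
      ∀ p₂ q₂ : ℝ, 1 < p₂ → p₂ ≤ q₂ → p₁ < p₂ →
        q₂ / conjExp p₂ = q₁ / conjExp p₁ →
        matApq volume dyadicsI0 W p₂ q₂ = ⊤ := by
  have hr₁ : 0 < conjExp p₁ := div_pos (by linarith) (by linarith)
  have ha : 0 < 1 / (2 * conjExp p₁) := by positivity
  have hq₁ : 0 < q₁ := by linarith
  refine ⟨tiltedWeight (1 / (2 * conjExp p₁)) q₁, integrableOn_tiltedWeight ha hq₁,
    ae_tiltedWeight_posDef ha hq₁, matApq_tiltedWeight_lt_top hp₁ hq₁, ?_⟩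
  intro p₂ q₂ hp₂ hpq₂ hp hq
  refine matApq_tiltedWeight_eq_top ha hp₂ (by linarith) ?_
  have hr₂ : 0 < conjExp p₂ := div_pos (by linarith) (by linarith)
  have hlt : conjExp p₂ < conjExp p₁ := by
    rw [conjExp, conjExp, div_lt_div_iff₀ (by linarith) (by linarith)]
    linarith
  rw [div_eq_div_iff hr₂.ne' hr₁.ne'] at hq
  by_contra! hle
  nlinarith

end
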